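/- arXiv:0809.4205 — 5 statements merged into one kernel-verified Lean document; each statement's English description precedes it below -/
import Mathlib

section
/- For every fixed 0 ≤ p < 1, every θ > 0 and every t > 0, the two zero-inflated negative binomial variables satisfy Z₁(t,θ,p) ≤cx Z₂(t,θ,p). -/
open MeasureTheory Filter Topology ProbabilityTheory

noncomputable section

/-- `ConvexOrder μ ν` means the distribution `μ` is dominated by `ν` in the convex order:
`∫ φ dμ ≤ ∫ φ dν` for every convex function `φ : ℝ → ℝ` for which both integrals are
well defined. -/
def ConvexOrder (μ ν : Measure ℝ) : Prop :=
  ∀ φ : ℝ → ℝ, ConvexOn ℝ Set.univ φ → Integrable φ μ → Integrable φ ν →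
    ∫ x, φ x ∂μ ≤ ∫ x, φ x ∂ν

/-- The discrete measure on `ℝ` supported on the nonnegative integers with weights `w k`. -/
def discreteMeasure (w : ℕ → ℝ) : Measure ℝ :=
  Measure.sum fun k => ENNReal.ofReal (w k) • Measure.dirac (k : ℝ)

/-- The Poisson probabilities with mean `θ`. -/
def poissonPMFReal (θ : ℝ) (k : ℕ) : ℝ := Real.exp (-θ) * θ ^ k / k.factorial

/-- The Poisson distribution with mean `θ`, as a measure on `ℝ`. -/
def poissonMeasure (θ : ℝ) : Measure ℝ := discreteMeasure (poissonPMFReal θ)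

/-- The binomial probabilities with parameters `m` and `q`. -/
def binomialPMFReal (m : ℕ) (q : ℝ) (k : ℕ) : ℝ :=
  (m.choose k) * q ^ k * (1 - q) ^ (m - k)

/-- The binomial distribution with parameters `m` and `q`, as a measure on `ℝ`. -/
def binomialMeasure (m : ℕ) (q : ℝ) : Measure ℝ := discreteMeasure (binomialPMFReal m q)

/-- The negative binomial probabilities: `P(Z(t,θ) = k) =
(Γ(k + 1/t)/(k! Γ(1/t))) (θt)^k / (1 + θt)^(k + 1/t)`; this distribution has mean `θ`. -/
def negBinomialPMFReal (t θ : ℝ) (k : ℕ) : ℝ :=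
  Real.Gamma (k + 1 / t) / (k.factorial * Real.Gamma (1 / t)) * (θ * t) ^ k /
    (1 + θ * t) ^ ((k : ℝ) + 1 / t)

/-- The negative binomial distribution `Z(t,θ)`, as a measure on `ℝ`. -/
def negBinomialMeasure (t θ : ℝ) : Measure ℝ := discreteMeasure (negBinomialPMFReal t θ)

/-- Zero inflation: the mixture of the point mass at `0` with weight `p` and `μ` with
weight `1 - p`. -/
def ziMeasure (p : ℝ) (μ : Measure ℝ) : Measure ℝ :=
  ENNReal.ofReal p • Measure.dirac (0 : ℝ) + ENNReal.ofReal (1 - p) • μ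

/-- The zero-inflated Poisson distribution `Y(θ,p)`: mixture of the point mass at `0` with
weight `p` and the Poisson distribution with mean `θ/(1-p)` with weight `1-p`. -/
def ZIP (θ p : ℝ) : Measure ℝ := ziMeasure p (poissonMeasure (θ / (1 - p)))

/-- The zero-inflated binomial distribution `X(m,θ,p)`: mixture of the point mass at `0` with
weight `p` and the binomial distribution with parameters `m` and `θ/(m(1-p))` with
weight `1-p`. -/
def ZIB (m : ℕ) (θ p : ℝ) : Measure ℝ :=
  ziMeasure p (binomialMeasure m (θ / (m * (1 - p))))

/-- The zero-inflated negative binomial distribution of the first kind `Z₁(t,θ,p)`: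
mixture of the point mass at `0` with weight `p` and `Z(t(1-p), θ/(1-p))` with weight `1-p`. -/
def ZINB₁ (t θ p : ℝ) : Measure ℝ :=
  ziMeasure p (negBinomialMeasure (t * (1 - p)) (θ / (1 - p)))

/-- The zero-inflated negative binomial distribution of the second kind `Z₂(t,θ,p)`:
mixture of the point mass at `0` with weight `p` and `Z(t, θ/(1-p))` with weight `1-p`. -/
def ZINB₂ (t θ p : ℝ) : Measure ℝ :=
  ziMeasure p (negBinomialMeasure t (θ / (1 - p)))

/-- The probability mass function of the zero-inflated negative binomial
distribution `Z₂(t,θ,p)`. -/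
def zinb2PMFReal (t θ p : ℝ) (k : ℕ) : ℝ :=
  (if k = 0 then p else 0) + (1 - p) * negBinomialPMFReal t (θ / (1 - p)) k

/-- The expected value of the maximum of `k` independent copies of a random variable with
distribution `μ`. -/
def expMax (μ : Measure ℝ) (k : ℕ) : ℝ :=
  ∫ x : Fin k → ℝ, (⨆ i, x i) ∂(Measure.pi fun _ => μ)

/-- The expected value of the minimum of `k` independent copies of a random variable with
distribution `μ`. -/
def expMin (μ : Measure ℝ) (k : ℕ) : ℝ :=
  ∫ x : Fin k → ℝ, (⨅ i, x i) ∂(Measure.pi fun _ => μ)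

/-- The modified Bessel function of the first kind of integer order `n`. -/
def besselI (n : ℕ) (x : ℝ) : ℝ :=
  ∑' j : ℕ, (x / 2) ^ (2 * j + n) / (j.factorial * (j + n).factorial)

/-- `M₂ θ`: the expected value of the maximum of two independent Poisson random variables
with mean `θ`. -/
def M₂ (x : ℝ) : ℝ := x + x * Real.exp (-2 * x) * (besselI 0 (2 * x) + besselI 1 (2 * x))

/-- The discrepancy `Δ₂:₂(θ,p) = 2pθ + (1-p)² M₂(θ/(1-p)) − M₂(θ)`. -/
def Δdisc (θ p : ℝ) : ℝ := 2 * p * θ + (1 - p) ^ 2 * M₂ (θ / (1 - p)) - M₂ θ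

/-- The asymptotic variance `σ²(θ)` of `√n Δ₂:₂` under the Poisson null hypothesis. -/
def σsq (θ : ℝ) : ℝ :=
  θ ^ 2 * (1 - Real.exp (-2 * θ) *
      ((1 + θ) * besselI 0 (2 * θ) - besselI 1 (2 * θ) + θ * besselI 2 (2 * θ))) ^ 2 /
    (Real.exp θ - 1 - θ)


/-- The negative binomial weights in terms of the shape `a` and the odds `x`. -/
def negBinomialWeight (a x : ℝ) (k : ℕ) : ℝ :=
  Real.Gamma (k + a) / (k.factorial * Real.Gamma a) * x ^ k / (1 + x) ^ ((k : ℝ) + a)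

lemma negBinomialWeight_pos {a x : ℝ} (ha : 0 < a) (hx : 0 < x) (k : ℕ) :
    0 < negBinomialWeight a x k := by
  have := Real.Gamma_pos_of_pos ha
  have := Real.Gamma_pos_of_pos (show 0 < (k : ℝ) + a by positivity)
  unfold negBinomialWeight
  positivity

lemma negBinomialWeight_succ {a x : ℝ} (ha : 0 < a) (hx : 0 < x) (k : ℕ) :
    negBinomialWeight a x (k + 1) =
      negBinomialWeight a x k * (((k + a) * (x / (1 + x))) / (k + 1)) := by
  have h1 := (Real.Gamma_pos_of_pos ha).ne'
  have h2 : (k : ℝ) + a ≠ 0 := by positivity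
  have h3 : (1 + x) ≠ 0 := by positivity
  have h4 : (1 + x) ^ ((k : ℝ) + a) ≠ 0 := by positivity
  have h5 : ((k + 1 : ℕ) : ℝ) + a = (k + a) + 1 := by push_cast; ring
  unfold negBinomialWeight
  rw [h5, Real.Gamma_add_one h2, Real.rpow_add_one h3, Nat.factorial_succ]
  push_cast
  field_simp
  ring

lemma succ_mul_negBinomialWeight_succ {a x : ℝ} (ha : 0 < a) (hx : 0 < x) (k : ℕ) :
    ((k + 1 : ℕ) : ℝ) * negBinomialWeight a x (k + 1) =
      a * x * negBinomialWeight (a + 1) x k := by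
  have h1 := (Real.Gamma_pos_of_pos ha).ne'
  have h4 : (1 + x) ^ ((k : ℝ) + (a + 1)) ≠ 0 := by positivity
  have h5 : ((k + 1 : ℕ) : ℝ) + a = k + (a + 1) := by push_cast; ring
  unfold negBinomialWeight
  rw [h5, Real.Gamma_add_one ha.ne', Nat.factorial_succ]
  push_cast
  field_simp
  ring

lemma Gamma_nat_add_div_eq_choose {a : ℝ} (ha : 0 < a) (k : ℕ) :
    Real.Gamma (k + a) / (k.factorial * Real.Gamma a) = Ring.choose (a + k - 1) k := by
  have h1 := (Real.Gamma_pos_of_pos ha).ne'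
  have h2 : Real.Gamma (k + a) = (ascPochhammer ℝ k).eval a * Real.Gamma a := by
    induction k with
    | zero => simp
    | succ k ih =>
      rw [show ((k + 1 : ℕ) : ℝ) + a = (k + a) + 1 by push_cast; ring,
        Real.Gamma_add_one (by positivity), ih, ascPochhammer_succ_eval]
      ring
  have h3 := Ring.factorial_nsmul_multichoose_eq_ascPochhammer a k
  rw [Ring.multichoose_eq, Polynomial.ascPochhammer_smeval_eq_eval, nsmul_eq_mul] at h3
  rw [h2, ← h3]
  field_simp

lemma hasSum_negBinomialWeight {a x : ℝ} (ha : 0 < a) (hx : 0 < x) :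
    HasSum (negBinomialWeight a x) 1 := by
  have hq : x / (1 + x) < 1 := by rw [div_lt_one (by positivity)]; linarith
  have hq0 : 0 ≤ x / (1 + x) := by positivity
  have h := (Real.one_div_one_sub_rpow_hasFPowerSeriesOnBall_zero a).hasSum
    (y := x / (1 + x)) (by
      rw [← ENNReal.ofReal_one, Metric.eball_ofReal]
      rwa [Metric.mem_ball, dist_zero_right, Real.norm_of_nonneg hq0])
  have h1 : (1 + x) ^ a ≠ 0 := by positivity
  have h2 : 1 - (0 + x / (1 + x)) = (1 + x)⁻¹ := by field_simp; ring
  rw [h2, Real.inv_rpow (by positivity), one_div, inv_inv] at h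
  have h' := h.div_const ((1 + x) ^ a)
  rw [div_self h1] at h'
  convert! h' using 2 with k
  rw [FormalMultilinearSeries.ofScalars_apply_eq, negBinomialWeight,
    Gamma_nat_add_div_eq_choose ha, Real.rpow_add (by positivity), Real.rpow_natCast, smul_eq_mul,
    div_pow]
  field_simp

lemma hasSum_mul_negBinomialWeight {a x : ℝ} (ha : 0 < a) (hx : 0 < x) :
    HasSum (fun k : ℕ => (k : ℝ) * negBinomialWeight a x k) (a * x) := by
  rw [← hasSum_nat_add_iff' 1]
  simpa only [succ_mul_negBinomialWeight_succ ha hx, Finset.sum_range_one, Nat.cast_zero, zero_mul,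
    sub_zero, mul_one] using (hasSum_negBinomialWeight (a := a + 1) (by positivity) hx).mul_left (a * x)

/-- The set where the weights of larger shape dominate is order connected. -/
lemma negBinomialWeight_le_of_le_of_le {a b x y : ℝ} (hb : 0 < b) (hab : b ≤ a) (hx : 0 < x)
    (hy : 0 < y) {i k j : ℕ} (hik : i ≤ k) (hkj : k ≤ j)
    (hi : negBinomialWeight b y i ≤ negBinomialWeight a x i)
    (hj : negBinomialWeight b y j ≤ negBinomialWeight a x j) :
    negBinomialWeight b y k ≤ negBinomialWeight a x k := by
  have ha : 0 < a := hb.trans_le hab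
  have hX : 0 < x / (1 + x) := by positivity
  have hY : 0 < y / (1 + y) := by positivity
  set X := x / (1 + x) with hXdef
  set Y := y / (1 + y) with hYdef
  have key : ∀ m n : ℕ, m ≤ n → (n + b) * Y ≤ (n + a) * X → (m + b) * Y ≤ (m + a) * X := by
    intro m n hmn h
    have hmn' : (m : ℝ) ≤ n := by exact_mod_cast hmn
    rcases le_total Y X with hYX | hXY
    · gcongr
    · nlinarith [mul_nonneg (sub_nonneg.2 hmn') (sub_nonneg.2 hXY)]
  by_cases hk : (k + b) * Y ≤ (k + a) * X
  · have up : ∀ m, i ≤ m → m ≤ k → negBinomialWeight b y m ≤ negBinomialWeight a x m := by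
      intro m him
      induction m, him using Nat.le_induction with
      | base => exact fun _ => hi
      | succ m _ ih =>
        intro hmk
        have h1 := ih (by omega)
        have h2 := key m k (by omega) hk
        rw [negBinomialWeight_succ hb hy, negBinomialWeight_succ ha hx, ← hXdef, ← hYdef]
        have := (negBinomialWeight_pos ha hx m).le
        gcongr
    exact up k hik le_rfl
  · by_contra hlt
    have down : ∀ m, k ≤ m → negBinomialWeight a x m < negBinomialWeight b y m := by
      intro m hkm
      induction m, hkm using Nat.le_induction with
      | base => exact not_le.1 hlt
      | succ m hkm ih =>
        have h2 : (m + a) * X < (m + b) * Y := not_le.1 fun h => hk (key k m hkm h)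
        rw [negBinomialWeight_succ hb hy, negBinomialWeight_succ ha hx, ← hXdef, ← hYdef]
        have := negBinomialWeight_pos ha hx m
        gcongr
    exact absurd hj (not_le.2 (down j hkj))

/-- The chord of a convex function through `x < y` lies above it on `[x, y]` and
below it elsewhere. -/
lemma ConvexOn.exists_chord {φ : ℝ → ℝ} (hφ : ConvexOn ℝ Set.univ φ) {x y : ℝ} (hxy : x < y) :
    ∃ c e : ℝ, (∀ z, x ≤ z → z ≤ y → φ z ≤ c * z + e) ∧
      (∀ z, z ≤ x → c * z + e ≤ φ z) ∧ (∀ z, y ≤ z → c * z + e ≤ φ z) := by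
  have three : ∀ u v w : ℝ, u ≤ v → v ≤ w →
      (w - u) * φ v ≤ (w - v) * φ u + (v - u) * φ w := by
    intro u v w huv hvw
    rcases (huv.trans hvw).eq_or_lt with h | h
    · obtain rfl : u = w := h
      obtain rfl : u = v := le_antisymm huv hvw
      simp
    · have hpos : 0 < w - u := by linarith
      have h1 := hφ.2 (Set.mem_univ u) (Set.mem_univ w)
        (div_nonneg (sub_nonneg.2 hvw) hpos.le) (div_nonneg (sub_nonneg.2 huv) hpos.le)
        (by field_simp; ring)
      have h2 : ((w - v) / (w - u)) • u + ((v - u) / (w - u)) • w = v := by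
        simp only [smul_eq_mul]; field_simp; ring
      rw [h2] at h1
      simp only [smul_eq_mul] at h1
      calc (w - u) * φ v
          ≤ (w - u) * ((w - v) / (w - u) * φ u + (v - u) / (w - u) * φ w) := by gcongr
        _ = _ := by field_simp
  have hpos : 0 < y - x := by linarith
  have hline : ∀ z, (y - x) * ((φ y - φ x) / (y - x) * z + (φ x - (φ y - φ x) / (y - x) * x)) =
      (y - z) * φ x + (z - x) * φ y := by
    intro z; field_simp; ring
  refine ⟨(φ y - φ x) / (y - x), φ x - (φ y - φ x) / (y - x) * x, ?_, ?_, ?_⟩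
  · intro z h1 h2
    refine le_of_mul_le_mul_left ?_ hpos
    rw [hline]
    exact three x z y h1 h2
  · intro z h1
    refine le_of_mul_le_mul_left ?_ hpos
    rw [hline]
    linarith [three z x y h1 hxy.le]
  · intro z h1
    refine le_of_mul_le_mul_left ?_ hpos
    rw [hline]
    linarith [three x y z hxy.le h1]

/-- The cut criterion for the convex order: a signed sequence of total mass and mean zero,
nonnegative exactly on an order connected set, integrates convex functions to a nonpositive
value. -/
lemma ConvexOn.tsum_mul_nonpos_of_ordConnected {d : ℕ → ℝ} {φ : ℝ → ℝ}
    (hφ : ConvexOn ℝ Set.univ φ) (hd0 : HasSum d 0)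
    (hd1 : HasSum (fun k : ℕ => (k : ℝ) * d k) 0)
    (hconn : ∀ i k j : ℕ, i ≤ k → k ≤ j → 0 ≤ d i → 0 ≤ d j → 0 ≤ d k)
    (hs : Summable fun k : ℕ => d k * φ k) : ∑' k : ℕ, d k * φ k ≤ 0 := by
  have hne : ∃ k, 0 ≤ d k := by
    by_contra! h
    have h0 := (hasSum_zero_iff_of_nonneg (f := fun k => -d k)
      (fun k => by simpa using (h k).le)).1 (by simpa using hd0.neg)
    have := congrFun h0 0
    have := h 0
    simp_all
  classical
  set a := Nat.find hne with ha
  have ha0 : 0 ≤ d a := Nat.find_spec hne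
  have hlt : ∀ k < a, d k < 0 := fun k hk => not_le.1 (Nat.find_min hne hk)
  by_cases hbdd : BddAbove {k | 0 ≤ d k}
  · obtain ⟨b, hb0, hb⟩ : ∃ b, 0 ≤ d b ∧ ∀ k, 0 ≤ d k → k ≤ b :=
      ⟨sSup {k | 0 ≤ d k}, Nat.sSup_mem hne hbdd, fun k hk => le_csSup hbdd hk⟩
    have hab : a ≤ b := hb a ha0
    obtain ⟨c, e, hmid, hleft, hright⟩ := hφ.exists_chord
      (x := (a : ℝ)) (y := ((max b (a + 1) : ℕ) : ℝ)) (by exact_mod_cast (by omega))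
    have hzero : HasSum (fun k : ℕ => d k * (c * k + e)) 0 := by
      convert! (hd1.mul_left c).add (hd0.mul_left e) using 2 with k
      · ring
      · simp
    have hle : ∀ k : ℕ, d k * φ k ≤ d k * (c * k + e) := by
      intro k
      rcases lt_or_ge k a with hk | hk
      · exact mul_le_mul_of_nonpos_left (hleft k (by exact_mod_cast hk.le)) (hlt k hk).le
      rcases le_or_gt k b with hkb | hkb
      · exact mul_le_mul_of_nonneg_left
          (hmid k (by exact_mod_cast hk) (by exact_mod_cast (by omega))) (hconn a k b hk hkb ha0 hb0)
      · exact mul_le_mul_of_nonpos_left (hright k (by exact_mod_cast (by omega)))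
          (not_le.1 fun h => by have := hb k h; omega).le
    exact hzero.tsum_eq ▸ hs.tsum_le_tsum hle hzero.summable
  · have hge : ∀ k, a ≤ k → 0 ≤ d k := by
      intro k hk
      rw [not_bddAbove_iff] at hbdd
      obtain ⟨j, hj, hkj⟩ := hbdd k
      exact hconn a k j hk hkj.le ha0 hj
    have hsum : HasSum (fun k : ℕ => d k * ((k : ℝ) - a)) 0 := by
      convert! hd1.sub (hd0.mul_left (a : ℝ)) using 2 with k
      · ring
      · simp
    have hz := (hasSum_zero_iff_of_nonneg (fun k => by
      rcases lt_or_ge k a with hk | hk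
      · exact mul_nonneg_of_nonpos_of_nonpos (hlt k hk).le
          (sub_nonpos.2 (by exact_mod_cast hk.le))
      · exact mul_nonneg (hge k hk) (sub_nonneg.2 (by exact_mod_cast hk)))).1 hsum
    have hoff : ∀ k, k ≠ a → d k = 0 := by
      intro k hk
      have h1 : d k * ((k : ℝ) - a) = 0 := congrFun hz k
      exact (mul_eq_zero.1 h1).resolve_right (sub_ne_zero.2 (by exact_mod_cast hk))
    have hda : d a = 0 := (hasSum_single a hoff).unique hd0
    have hall : ∀ k, d k = 0 := fun k => by
      by_cases hk : k = a
      · rw [hk, hda]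
      · exact hoff k hk
    simp [hall]

lemma hasSum_integral_discreteMeasure {w : ℕ → ℝ} (hw : ∀ k, 0 ≤ w k) {φ : ℝ → ℝ}
    (hφ : Integrable φ (discreteMeasure w)) :
    HasSum (fun k : ℕ => w k * φ k) (∫ x, φ x ∂discreteMeasure w) := by
  convert! hasSum_integral_measure hφ using 2 with k
  rw [integral_smul_measure, integral_dirac, ENNReal.toReal_ofReal (hw k), smul_eq_mul]

lemma negBinomialMeasure_convexOrder {s t μ : ℝ} (hs : 0 < s) (hst : s ≤ t) (hμ : 0 < μ) :
    ConvexOrder (negBinomialMeasure s μ) (negBinomialMeasure t μ) := by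
  intro φ hφ h1 h2
  have ht : 0 < t := hs.trans_le hst
  have has : 0 < 1 / s := by positivity
  have hat : 0 < 1 / t := by positivity
  have hxs : 0 < μ * s := by positivity
  have hxt : 0 < μ * t := by positivity
  have H1 := hasSum_integral_discreteMeasure (fun k => (negBinomialWeight_pos has hxs k).le) h1
  have H2 := hasSum_integral_discreteMeasure (fun k => (negBinomialWeight_pos hat hxt k).le) h2
  have H := H1.sub H2
  simp only [← sub_mul] at H
  have hmean : 1 / s * (μ * s) - 1 / t * (μ * t) = 0 := by field_simp; ring
  have hle := hφ.tsum_mul_nonpos_of_ordConnected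
    (d := fun k => negBinomialWeight (1 / s) (μ * s) k - negBinomialWeight (1 / t) (μ * t) k)
    (by simpa using (hasSum_negBinomialWeight has hxs).sub (hasSum_negBinomialWeight hat hxt))
    (by
      have := (hasSum_mul_negBinomialWeight has hxs).sub (hasSum_mul_negBinomialWeight hat hxt)
      rw [hmean] at this
      simpa only [mul_sub] using this)
    (fun i k j hik hkj hi hj => sub_nonneg.2
      (negBinomialWeight_le_of_le_of_le hat (one_div_le_one_div_of_le hs hst) hxs hxt hik hkj
        (sub_nonneg.1 hi) (sub_nonneg.1 hj)))
    H.summable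
  rw [H.tsum_eq] at hle
  exact sub_nonpos.1 hle

lemma ConvexOrder.ziMeasure {μ ν : Measure ℝ} (h : ConvexOrder μ ν) {p : ℝ} (hp : p < 1) :
    ConvexOrder (ziMeasure p μ) (ziMeasure p ν) := by
  intro φ hφ h1 h2
  have hc : ENNReal.ofReal (1 - p) ≠ 0 := by simpa using hp
  have hμ := (integrable_smul_measure hc ENNReal.ofReal_ne_top).1 h1.right_of_add_measure
  have hν := (integrable_smul_measure hc ENNReal.ofReal_ne_top).1 h2.right_of_add_measure
  unfold _root_.ziMeasure
  rw [integral_add_measure h1.left_of_add_measure h1.right_of_add_measure,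
    integral_add_measure h2.left_of_add_measure h2.right_of_add_measure,
    integral_smul_measure, integral_smul_measure _ (ENNReal.ofReal (1 - p)),
    integral_smul_measure _ (ENNReal.ofReal (1 - p))]
  exact add_le_add_right (smul_le_smul_of_nonneg_left (h φ hφ hμ hν) ENNReal.toReal_nonneg) _

/-- For every fixed `0 ≤ p < 1`, every `θ > 0` and every `t > 0`, the two
zero-inflated negative binomial distributions satisfy `Z₁(t,θ,p) ≤cx Z₂(t,θ,p)`. -/
theorem zinb1_convexOrder_zinb2 (p : ℝ) (hp₀ : 0 ≤ p) (hp₁ : p < 1)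
    (θ t : ℝ) (hθ : 0 < θ) (ht : 0 < t) :
    ConvexOrder (ZINB₁ t θ p) (ZINB₂ t θ p) := by
  exact (negBinomialMeasure_convexOrder (mul_pos ht (sub_pos.2 hp₁))
    (mul_le_of_le_one_right ht.le (by linarith)) (div_pos hθ (sub_pos.2 hp₁))).ziMeasure hp₁

end
end

section
/- For every θ > 0, the expected value of the maximum of two independent Poisson random variables with mean θ equals M₂(θ) = θ + θ e^{-2θ} (I₀(2θ) + I₁(2θ)), where I₀ and I₁ are the modified Bessel functions of the first kind. -/
open MeasureTheory Filter Topology ProbabilityTheory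

noncomputable section

namespace PoissonMax

lemma poissonPMFReal_nonneg {θ : ℝ} (hθ : 0 ≤ θ) (k : ℕ) : 0 ≤ _root_.poissonPMFReal θ k := by
  unfold _root_.poissonPMFReal
  positivity

lemma hasSum_poissonPMFReal {θ : ℝ} (hθ : 0 ≤ θ) : HasSum (_root_.poissonPMFReal θ) 1 :=
  hasSum_one_poissonMeasure ⟨θ, hθ⟩

lemma poissonPMFReal_succ (θ : ℝ) (k : ℕ) :
    _root_.poissonPMFReal θ (k + 1) * ((k + 1 : ℕ) : ℝ) = θ * _root_.poissonPMFReal θ k := by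
  unfold _root_.poissonPMFReal
  rw [Nat.factorial_succ]
  push_cast
  field_simp
  ring

lemma discreteMeasure_prod {w : ℕ → ℝ} (hw : ∀ k, 0 ≤ w k) :
    (discreteMeasure w).prod (discreteMeasure w) =
      Measure.sum fun p : ℕ × ℕ =>
        ENNReal.ofReal (w p.1 * w p.2) • Measure.dirac ((p.1 : ℝ), (p.2 : ℝ)) := by
  unfold discreteMeasure
  rw [Measure.prod_sum]
  congr 1
  ext1 p
  rw [Measure.prod_smul_left, Measure.prod_smul_right, Measure.dirac_prod_dirac, smul_smul,
    ENNReal.ofReal_mul (hw _)]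

lemma expMax_discreteMeasure_two {w : ℕ → ℝ} (hw : ∀ k, 0 ≤ w k) (hw1 : HasSum w 1) :
    expMax (discreteMeasure w) 2 =
      ∑' p : ℕ × ℕ, w p.1 * w p.2 * max (p.1 : ℝ) (p.2 : ℝ) := by
  have : IsProbabilityMeasure (discreteMeasure w) := hw1.isProbabilityMeasure_sum_dirac hw
  have h := (measurePreserving_finTwoArrow (discreteMeasure w)).integral_comp'
    (fun p : ℝ × ℝ => max p.1 p.2)
  have hsup (x : Fin 2 → ℝ) : ⨆ i, x i = max (x 0) (x 1) := by
    rw [← Finset.sup'_univ_eq_ciSup]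
    simp [Finset.univ_fin2]
  have hE : expMax (discreteMeasure w) 2 =
      ∫ p : ℝ × ℝ, max p.1 p.2 ∂(discreteMeasure w).prod (discreteMeasure w) := by
    rw [← h, expMax]
    simp [hsup]
  rw [hE, discreteMeasure_prod hw, integral_sum_dirac (by simp)]
  congr with p
  rw [ENNReal.toReal_ofReal (mul_nonneg (hw _) (hw _)), smul_eq_mul]

lemma hasSum_poissonPMFReal_mul {θ : ℝ} (hθ : 0 ≤ θ) :
    HasSum (fun p : ℕ × ℕ => _root_.poissonPMFReal θ p.1 * _root_.poissonPMFReal θ p.2) 1 := by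
  have h := hasSum_poissonPMFReal hθ
  simpa using h.mul h (h.summable.mul_of_nonneg h.summable
    (poissonPMFReal_nonneg hθ) (poissonPMFReal_nonneg hθ))

lemma hasSum_swap {w : ℕ → ℝ} {g : ℕ × ℕ → ℝ} {s : ℝ}
    (h : HasSum (fun p : ℕ × ℕ => w p.1 * w p.2 * g p) s) :
    HasSum (fun p : ℕ × ℕ => w p.1 * w p.2 * g p.swap) s := by
  rw [← (Equiv.prodComm ℕ ℕ).hasSum_iff] at h
  refine h.congr_fun ?_
  intro p
  simp [mul_comm]

/-- The Stein–Chen identity `E[X g(X, Y)] = θ E[g(X + 1, Y)]`. -/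
lemma hasSum_stein {θ : ℝ} {g : ℕ × ℕ → ℝ} {s : ℝ}
    (h : HasSum (fun p : ℕ × ℕ =>
      _root_.poissonPMFReal θ p.1 * _root_.poissonPMFReal θ p.2 * g (p.1 + 1, p.2)) s) :
    HasSum (fun p : ℕ × ℕ =>
      _root_.poissonPMFReal θ p.1 * _root_.poissonPMFReal θ p.2 * (p.1 * g p)) (θ * s) := by
  have hinj : Function.Injective fun p : ℕ × ℕ => (p.1 + 1, p.2) := by
    rintro ⟨a, b⟩ ⟨c, d⟩ h
    simpa using h
  rw [← hinj.hasSum_iff]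
  · refine (h.mul_left θ).congr_fun ?_
    intro p
    simp only [Function.comp_apply]
    linear_combination (_root_.poissonPMFReal θ p.2 * g (p.1 + 1, p.2)) *
      poissonPMFReal_succ θ p.1
  · rintro ⟨a, b⟩ hab
    cases a with
    | zero => simp
    | succ a => exact absurd ⟨(a, b), rfl⟩ hab

/-- `P(Y = X + n)` in terms of the modified Bessel function of order `n`. -/
lemma hasSum_diff_eq {θ : ℝ} (hθ : 0 ≤ θ) (n : ℕ) :
    HasSum (fun p : ℕ × ℕ => _root_.poissonPMFReal θ p.1 * _root_.poissonPMFReal θ p.2 *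
      if p.2 = p.1 + n then 1 else 0) (Real.exp (-2 * θ) * besselI n (2 * θ)) := by
  have hinj : Function.Injective fun j : ℕ => (j, j + n) := fun a b h => (Prod.ext_iff.1 h).1
  have hexp : Real.exp (-θ) * Real.exp (-θ) = Real.exp (-2 * θ) := by
    rw [← Real.exp_add]
    ring_nf
  have hterm (j : ℕ) : _root_.poissonPMFReal θ j * _root_.poissonPMFReal θ (j + n) =
      Real.exp (-2 * θ) *
        ((2 * θ / 2) ^ (2 * j + n) / (j.factorial * (j + n).factorial)) := by
    unfold _root_.poissonPMFReal
    rw [← hexp, mul_div_cancel_left₀ θ two_ne_zero]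
    ring
  have hsum := (hasSum_poissonPMFReal_mul hθ).summable.comp_injective hinj
  rw [← hinj.hasSum_iff]
  · rw [besselI, ← tsum_mul_left]
    convert! hsum.hasSum using 1
    · ext j
      simp
    · simp [hterm]
  · rintro ⟨a, b⟩ hab
    have : b ≠ a + n := fun h => hab ⟨a, by simp [h]⟩
    simp [this]

/-- `P(Y ≤ X) = (1 + P(X = Y)) / 2`. -/
lemma hasSum_le {θ : ℝ} (hθ : 0 ≤ θ) :
    HasSum (fun p : ℕ × ℕ => _root_.poissonPMFReal θ p.1 * _root_.poissonPMFReal θ p.2 *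
      if p.2 ≤ p.1 then 1 else 0) ((1 + Real.exp (-2 * θ) * besselI 0 (2 * θ)) / 2) := by
  have h1 := hasSum_poissonPMFReal_mul hθ
  obtain ⟨s, hs⟩ : Summable (fun p : ℕ × ℕ => _root_.poissonPMFReal θ p.1 *
      _root_.poissonPMFReal θ p.2 * if p.2 ≤ p.1 then 1 else 0) := by
    refine h1.summable.of_nonneg_of_le (fun p => ?_) (fun p => ?_) <;>
    have := mul_nonneg (poissonPMFReal_nonneg hθ p.1) (poissonPMFReal_nonneg hθ p.2) <;>
    split_ifs <;> simp [this]
  have h := (hs.add (hasSum_swap hs)).unique <|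
    (h1.add (hasSum_diff_eq hθ 0)).congr_fun (fun p => by
      rcases lt_trichotomy p.1 p.2 with h | h | h
      · simp [h.not_ge, h.le, h.ne']
      · simp [h]
      · simp [h.not_ge, h.le, h.ne])
  convert! hs using 1
  linarith

/-- `P(Y ≤ X + 1) = (1 + P(X = Y)) / 2 + P(Y = X + 1)`. -/
lemma hasSum_le_succ {θ : ℝ} (hθ : 0 ≤ θ) :
    HasSum (fun p : ℕ × ℕ => _root_.poissonPMFReal θ p.1 * _root_.poissonPMFReal θ p.2 *
      if p.2 ≤ p.1 + 1 then 1 else 0)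
      ((1 + Real.exp (-2 * θ) * besselI 0 (2 * θ)) / 2 +
        Real.exp (-2 * θ) * besselI 1 (2 * θ)) := by
  refine ((hasSum_le hθ).add (hasSum_diff_eq hθ 1)).congr_fun fun p => ?_
  rw [← mul_add]
  congr 1
  split_ifs <;> first | omega | simp

lemma hasSum_max {θ : ℝ} (hθ : 0 ≤ θ) :
    HasSum (fun p : ℕ × ℕ => _root_.poissonPMFReal θ p.1 * _root_.poissonPMFReal θ p.2 *
      max (p.1 : ℝ) (p.2 : ℝ))
      (θ + θ * Real.exp (-2 * θ) * (besselI 0 (2 * θ) + besselI 1 (2 * θ))) := by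
  have hlt := hasSum_stein (g := fun p => if p.2 < p.1 then 1 else 0) (θ := θ)
    (by simpa only [Nat.lt_succ_iff] using hasSum_le hθ)
  have hle := hasSum_swap <| hasSum_stein (g := fun p => if p.2 ≤ p.1 then 1 else 0) (θ := θ)
    (hasSum_le_succ hθ)
  convert! hlt.add hle using 1
  · ext p
    rw [← mul_add]
    congr 1
    rcases lt_or_ge p.2 p.1 with h | h
    · simp [h, h.not_ge, h.le]
    · simp [h, h.not_gt]
  · ring

end PoissonMax

/-- For every `θ > 0`, the expected value of the maximum of two independent
Poisson random variables with mean `θ` equals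
`M₂(θ) = θ + θ e^{-2θ} (I₀(2θ) + I₁(2θ))`, with `I₀`, `I₁` modified Bessel functions of the
first kind. -/
theorem expMax_two_poisson (θ : ℝ) (hθ : 0 < θ) :
    expMax (poissonMeasure θ) 2 =
      θ + θ * Real.exp (-2 * θ) * (besselI 0 (2 * θ) + besselI 1 (2 * θ)) := by
  rw [_root_.poissonMeasure, PoissonMax.expMax_discreteMeasure_two
    (PoissonMax.poissonPMFReal_nonneg hθ.le) (PoissonMax.hasSum_poissonPMFReal hθ.le)]
  exact (PoissonMax.hasSum_max hθ.le).tsum_eq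

end
end

section
/- For t > 0 and θ > 0, the function f(p) := P(Z₂(t,θ,p) = 0) = p + (1-p)(1 + θt/(1-p))^{-1/t} is strictly increasing in p on the interval [0,1). -/
open MeasureTheory Filter Topology ProbabilityTheory

noncomputable section

/-- A power function with negative exponent is strictly convex on the positive half-line. -/
theorem strictConvexOn_rpow_neg {a : ℝ} (ha : 0 < a) :
    StrictConvexOn ℝ (Set.Ioi 0) fun x : ℝ => x ^ (-a) := by
  refine ⟨convex_Ioi 0, fun x hx y hy hxy u v hu hv huv => ?_⟩
  have hx' : 0 < x := hx
  have hy' : 0 < y := hy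
  have hlog := strictConcaveOn_log_Ioi.2 hx hy hxy hu hv huv
  have hexp := convexOn_exp.2 (Set.mem_univ (Real.log x * -a)) (Set.mem_univ (Real.log y * -a))
    hu.le hv.le huv
  simp only [smul_eq_mul] at hlog hexp ⊢
  have hpos : 0 < u * x + v * y := by positivity
  rw [Real.rpow_def_of_pos hx', Real.rpow_def_of_pos hy', Real.rpow_def_of_pos hpos]
  refine lt_of_lt_of_le (Real.exp_lt_exp.mpr ?_) hexp
  nlinarith [mul_lt_mul_of_pos_right hlog ha]

/-- The perspective `q ↦ q (1 + c / q) ^ (-a)` grows strictly slower than `q`. -/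
theorem mul_one_add_div_rpow_neg_sub_lt {a c q r : ℝ} (ha : 0 < a) (hc : 0 < c) (hq : 0 < q)
    (hqr : q < r) :
    r * (1 + c / r) ^ (-a) - q * (1 + c / q) ^ (-a) < r - q := by
  have hr : 0 < r := hq.trans hqr
  have hcq : 0 < c / q := div_pos hc hq
  have h := (strictConvexOn_rpow_neg ha).2 (x := 1 + c / q) (y := 1)
    (Set.mem_Ioi.mpr (by linarith)) (Set.mem_Ioi.mpr one_pos) (by linarith)
    (div_pos hq hr) (div_pos (sub_pos.mpr hqr) hr) (by field_simp; ring)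
  simp only [smul_eq_mul, Real.one_rpow, mul_one] at h
  have hcomb : q / r * (1 + c / q) + (r - q) / r = 1 + c / r := by field_simp; ring
  rw [hcomb] at h
  have hmul := mul_lt_mul_of_pos_left h hr
  have hexpand : r * (q / r * (1 + c / q) ^ (-a) + (r - q) / r)
      = q * (1 + c / q) ^ (-a) + (r - q) := by
    generalize (1 + c / q) ^ (-a) = A
    field_simp
  linarith

/-- The probability that a negative binomial variable vanishes. -/
theorem negBinomialPMFReal_zero {t θ : ℝ} (ht : 0 < t) (hθ : 0 ≤ θ) :
    negBinomialPMFReal t θ 0 = (1 + θ * t) ^ (-(1 / t)) := by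
  have hΓ : Real.Gamma (1 / t) ≠ 0 := (Real.Gamma_pos_of_pos (by positivity)).ne'
  rw [Real.rpow_neg (by positivity)]
  simp only [negBinomialPMFReal, Nat.cast_zero, zero_add, Nat.factorial_zero, Nat.cast_one,
    one_mul, pow_zero, mul_one]
  rw [div_self hΓ, one_div]

/-- For `t > 0` and `θ > 0`, the function
`f(p) = P(Z₂(t,θ,p) = 0) = p + (1-p)(1 + θt/(1-p))^{-1/t}` is strictly increasing on `[0,1)`. -/
theorem zinb2_zero_prob_strictMonoOn (t θ : ℝ) (ht : 0 < t) (hθ : 0 < θ) :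
    (∀ p ∈ Set.Ico (0 : ℝ) 1,
        zinb2PMFReal t θ p 0 = p + (1 - p) * (1 + θ * t / (1 - p)) ^ (-(1 / t))) ∧
      StrictMonoOn (fun p => zinb2PMFReal t θ p 0) (Set.Ico (0 : ℝ) 1) := by
  have hzero : ∀ p ∈ Set.Ico (0 : ℝ) 1,
      zinb2PMFReal t θ p 0 = p + (1 - p) * (1 + θ * t / (1 - p)) ^ (-(1 / t)) := by
    intro p hp
    have hθp : 0 ≤ θ / (1 - p) := div_nonneg hθ.le (sub_nonneg.mpr hp.2.le)
    rw [zinb2PMFReal, if_pos rfl, negBinomialPMFReal_zero ht hθp, div_mul_eq_mul_div]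
  refine ⟨hzero, fun p hp p' hp' hlt => ?_⟩
  simp only [hzero p hp, hzero p' hp']
  have h := mul_one_add_div_rpow_neg_sub_lt (one_div_pos.mpr ht) (mul_pos hθ ht)
    (sub_pos.mpr hp'.2) (sub_lt_sub_left hlt 1)
  linarith

end
end

section
/- Fix t > 0, θ > 0 and 0 ≤ p₁ < p₂ < 1, and define φ(k) := P(Z₂(t,θ,p₁) = k) / P(Z₂(t,θ,p₂) = k) for integers k ≥ 0, and c := (1 - p₂ + θt)/(1 - p₁ + θt). Then c < 1, φ(k+1) = c·φ(k) for all k ≥ 1 (hence φ(k) = c^{k-1} φ(1) for k ≥ 1), φ(0) < 1 and φ(1) > 1. Consequently the difference k ↦ P(Z₂(t,θ,p₁)=k) − P(Z₂(t,θ,p₂)=k) is negative at k = 0, positive for k = 1, and has exactly two changes of sign, with sign sequence −, +, −. -/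
open MeasureTheory Filter Topology ProbabilityTheory

noncomputable section

/-- Closed form of the negative binomial weights in terms of `r = q / (q + θt)`. -/
lemma mul_negBinomialPMFReal_div {t θ q : ℝ} (ht : 0 < t) (hθ : 0 < θ) (hq : 0 < q) (k : ℕ) :
    q * negBinomialPMFReal t (θ / q) k =
      Real.Gamma (k + 1 / t) / (k.factorial * Real.Gamma (1 / t)) * (θ * t) ^ k *
        ((q / (q + θ * t)) ^ (1 + 1 / t) * ((q + θ * t) / (q + θ * t) ^ k)) := by
  have hv : 0 < q + θ * t := by positivity
  have h1 : 1 + θ / q * t = (q + θ * t) / q := by field_simp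
  have h2 : θ / q * t = θ * t / q := by ring
  have hqs : 0 < q ^ (1 / t) := Real.rpow_pos_of_pos hq _
  have hvs : 0 < (q + θ * t) ^ (1 / t) := Real.rpow_pos_of_pos hv _
  have hG : 0 < Real.Gamma (1 / t) := Real.Gamma_pos_of_pos (by positivity)
  unfold negBinomialPMFReal
  rw [h1, h2, Real.rpow_add (by positivity), Real.rpow_add (by positivity), Real.rpow_natCast,
    Real.rpow_one, Real.div_rpow hv.le hq.le, Real.div_rpow hq.le hv.le, div_pow, div_pow]
  generalize q ^ (1 / t) = a at *
  generalize (q + θ * t) ^ (1 / t) = b at *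
  field_simp

lemma zinb2PMFReal_zero {t θ p : ℝ} (ht : 0 < t) (hθ : 0 < θ) (hp : p < 1) :
    zinb2PMFReal t θ p 0 =
      p + (1 - p + θ * t) * ((1 - p) / (1 - p + θ * t)) ^ (1 + 1 / t) := by
  have hG : Real.Gamma (1 / t) ≠ 0 := (Real.Gamma_pos_of_pos (by positivity)).ne'
  rw [zinb2PMFReal, mul_negBinomialPMFReal_div ht hθ (sub_pos.2 hp)]
  simp only [if_true, Nat.cast_zero, zero_add, Nat.factorial_zero, Nat.cast_one, one_mul,
    div_self hG, pow_zero, div_one, mul_comm]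

lemma zinb2PMFReal_succ {t θ p : ℝ} (ht : 0 < t) (hθ : 0 < θ) (hp : p < 1) (k : ℕ) :
    zinb2PMFReal t θ p (k + 1) =
      Real.Gamma ((k + 1 : ℕ) + 1 / t) / ((k + 1).factorial * Real.Gamma (1 / t)) *
        (θ * t) ^ (k + 1) *
        (((1 - p) / (1 - p + θ * t)) ^ (1 + 1 / t) / (1 - p + θ * t) ^ k) := by
  have hq : 0 < 1 - p := sub_pos.2 hp
  have hv : 0 < 1 - p + θ * t := by positivity
  rw [zinb2PMFReal, mul_negBinomialPMFReal_div ht hθ hq, if_neg k.succ_ne_zero, zero_add,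
    pow_succ (1 - p + θ * t), div_mul_cancel_right₀ hv.ne', ← div_eq_mul_inv]

lemma zinb2PMFReal_pos {t θ p : ℝ} (ht : 0 < t) (hθ : 0 < θ) (hp₀ : 0 ≤ p) (hp : p < 1) (k : ℕ) :
    0 < zinb2PMFReal t θ p k := by
  have hq : 0 < 1 - p := sub_pos.2 hp
  cases k with
  | zero => rw [zinb2PMFReal_zero ht hθ hp]; positivity
  | succ k =>
    have hG : 0 < Real.Gamma (1 / t) := Real.Gamma_pos_of_pos (by positivity)
    have hG' : 0 < Real.Gamma ((k + 1 : ℕ) + 1 / t) := Real.Gamma_pos_of_pos (by positivity)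
    rw [zinb2PMFReal_succ ht hθ hp]
    positivity

lemma zinb2PMFReal_succ_div {t θ p₁ p₂ : ℝ} (ht : 0 < t) (hθ : 0 < θ) (hp₁ : p₁ < 1)
    (hp₂ : p₂ < 1) (k : ℕ) :
    zinb2PMFReal t θ p₁ (k + 1) / zinb2PMFReal t θ p₂ (k + 1) =
      ((1 - p₂ + θ * t) / (1 - p₁ + θ * t)) ^ k *
        (((1 - p₁) / (1 - p₁ + θ * t)) ^ (1 + 1 / t) /
          ((1 - p₂) / (1 - p₂ + θ * t)) ^ (1 + 1 / t)) := by
  have hq₁ : 0 < 1 - p₁ := sub_pos.2 hp₁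
  have hq₂ : 0 < 1 - p₂ := sub_pos.2 hp₂
  have hG : 0 < Real.Gamma (1 / t) := Real.Gamma_pos_of_pos (by positivity)
  have hG' : 0 < Real.Gamma ((k + 1 : ℕ) + 1 / t) := Real.Gamma_pos_of_pos (by positivity)
  rw [zinb2PMFReal_succ ht hθ hp₁, zinb2PMFReal_succ ht hθ hp₂,
    mul_div_mul_left _ _ (by positivity), div_pow, div_div_div_eq, div_mul_div_comm,
    mul_comm (_ ^ (1 + 1 / t))]

/-- The mass at `0` is strictly increasing in the inflation parameter. -/
lemma zinb2PMFReal_zero_lt {t θ p₁ p₂ : ℝ} (ht : 0 < t) (hθ : 0 < θ) (hp₁₂ : p₁ < p₂)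
    (hp₂ : p₂ < 1) : zinb2PMFReal t θ p₁ 0 < zinb2PMFReal t θ p₂ 0 := by
  have hp₁ := hp₁₂.trans hp₂
  have hq₁ : 0 < 1 - p₁ := sub_pos.2 hp₁
  have hq₂ : 0 < 1 - p₂ := sub_pos.2 hp₂
  have hu : 0 < θ * t := mul_pos hθ ht
  have hv₁ : 0 < 1 - p₁ + θ * t := by positivity
  have hv₂ : 0 < 1 - p₂ + θ * t := by positivity
  have hδ : 0 < p₂ - p₁ := sub_pos.2 hp₁₂
  rw [zinb2PMFReal_zero ht hθ hp₁, zinb2PMFReal_zero ht hθ hp₂]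
  have hs : 1 < 1 + 1 / t := lt_add_of_pos_right _ (by positivity)
  have hne : (1 - p₂) / (1 - p₂ + θ * t) ≠ 1 := by
    rw [Ne, div_eq_one_iff_eq hv₂.ne']; linarith
  have key := (strictConvexOn_rpow hs).2 (Set.mem_Ici.2 (div_pos hq₂ hv₂).le)
    (Set.mem_Ici.2 zero_le_one) hne (div_pos hv₂ hv₁) (div_pos hδ hv₁)
    (by field_simp; ring)
  simp only [smul_eq_mul, Real.one_rpow] at key
  have hr : (1 - p₂ + θ * t) / (1 - p₁ + θ * t) * ((1 - p₂) / (1 - p₂ + θ * t)) +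
      (p₂ - p₁) / (1 - p₁ + θ * t) * 1 = (1 - p₁) / (1 - p₁ + θ * t) := by
    field_simp; ring
  rw [hr] at key
  have := mul_lt_mul_of_pos_left key hv₁
  rw [mul_add, ← mul_assoc, mul_div_cancel₀ _ hv₁.ne', mul_one, mul_div_cancel₀ _ hv₁.ne'] at this
  linarith

/-- Fix `t > 0`, `θ > 0` and `0 ≤ p₁ < p₂ < 1`. With
`φ(k) = P(Z₂(t,θ,p₁)=k)/P(Z₂(t,θ,p₂)=k)` and `c = (1-p₂+θt)/(1-p₁+θt)` one has `c < 1`,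
`φ(k+1) = c φ(k)` for `k ≥ 1` (hence `φ(k) = c^(k-1) φ(1)` for `k ≥ 1`), `φ(0) < 1` and
`φ(1) > 1`. Consequently the difference `d(k) = P(Z₂(t,θ,p₁)=k) − P(Z₂(t,θ,p₂)=k)` is
negative at `k = 0`, positive at `k = 1`, and has exactly two changes of sign with
sign sequence `−, +, −`: the set of indices `k ≥ 1` where `d` is positive is an initial
segment, and `d` is eventually negative. -/
theorem zinb2_pmf_ratio_sign_changes (t θ p₁ p₂ : ℝ) (ht : 0 < t) (hθ : 0 < θ)
    (hp₁ : 0 ≤ p₁) (hp₁₂ : p₁ < p₂) (hp₂ : p₂ < 1) :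
    let φ : ℕ → ℝ := fun k => zinb2PMFReal t θ p₁ k / zinb2PMFReal t θ p₂ k
    let c : ℝ := (1 - p₂ + θ * t) / (1 - p₁ + θ * t)
    let d : ℕ → ℝ := fun k => zinb2PMFReal t θ p₁ k - zinb2PMFReal t θ p₂ k
    c < 1 ∧
    (∀ k : ℕ, 1 ≤ k → φ (k + 1) = c * φ k) ∧
    (∀ k : ℕ, 1 ≤ k → φ k = c ^ (k - 1) * φ 1) ∧
    φ 0 < 1 ∧
    1 < φ 1 ∧
    d 0 < 0 ∧
    0 < d 1 ∧
    (∀ j k : ℕ, 1 ≤ j → j ≤ k → 0 < d k → 0 < d j) ∧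
    (∃ K : ℕ, ∀ k : ℕ, K ≤ k → d k < 0) := by
  intro φ c d
  have hp₁' : p₁ < 1 := hp₁₂.trans hp₂
  have hq₁ : 0 < 1 - p₁ := sub_pos.2 hp₁'
  have hq₂ : 0 < 1 - p₂ := sub_pos.2 hp₂
  have hu : 0 < θ * t := mul_pos hθ ht
  have hv₁ : 0 < 1 - p₁ + θ * t := by positivity
  have hv₂ : 0 < 1 - p₂ + θ * t := by positivity
  have hpos (k) : 0 < zinb2PMFReal t θ p₂ k := zinb2PMFReal_pos ht hθ (hp₁.trans hp₁₂.le) hp₂ k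
  have hc0 : 0 < c := div_pos hv₂ hv₁
  have hc1 : c < 1 := (div_lt_one hv₁).2 (by linarith)
  have hφ (k : ℕ) : φ (k + 1) = c ^ k * φ 1 := by
    have h1 := zinb2PMFReal_succ_div ht hθ hp₁' hp₂ 0
    rw [pow_zero, one_mul, zero_add] at h1
    simp only [φ, c]
    rw [zinb2PMFReal_succ_div ht hθ hp₁' hp₂, h1]
  have hφ1 : 1 < φ 1 := by
    have h1 := zinb2PMFReal_succ_div ht hθ hp₁' hp₂ 0
    rw [pow_zero, one_mul, zero_add] at h1
    simp only [φ]
    rw [h1, one_lt_div (by positivity)]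
    apply Real.rpow_lt_rpow (by positivity) _ (by positivity)
    rw [div_lt_div_iff₀ hv₂ hv₁]
    nlinarith [mul_pos hu (sub_pos.2 hp₁₂)]
  have hdpos (k) : 0 < d k ↔ 1 < φ k := by
    simp only [d, φ]; rw [one_lt_div (hpos k), sub_pos]
  have hdneg (k) : d k < 0 ↔ φ k < 1 := by
    simp only [d, φ]; rw [div_lt_one (hpos k), sub_neg]
  have hφ0 : φ 0 < 1 := (div_lt_one (hpos 0)).2 (zinb2PMFReal_zero_lt ht hθ hp₁₂ hp₂)
  have hφ1pos : 0 < φ 1 := one_pos.trans hφ1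
  refine ⟨hc1, ?_, ?_, hφ0, hφ1, (hdneg 0).2 hφ0, (hdpos 1).2 hφ1, ?_, ?_⟩
  · intro k hk
    obtain ⟨k, rfl⟩ := Nat.exists_eq_add_of_le' hk
    rw [hφ (k + 1), hφ k, pow_succ']
    ring
  · intro k hk
    obtain ⟨k, rfl⟩ := Nat.exists_eq_add_of_le' hk
    rw [hφ k, Nat.add_sub_cancel]
  · intro j k hj hjk hk
    rw [hdpos] at hk ⊢
    obtain ⟨j, rfl⟩ := Nat.exists_eq_add_of_le' hj
    obtain ⟨k, rfl⟩ := Nat.exists_eq_add_of_le' (hj.trans hjk)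
    rw [hφ] at hk ⊢
    exact hk.trans_le (mul_le_mul_of_nonneg_right
      (pow_le_pow_of_le_one hc0.le hc1.le (by omega)) hφ1pos.le)
  · obtain ⟨n, hn⟩ := exists_pow_lt_of_lt_one (inv_pos.2 hφ1pos) hc1
    refine ⟨n + 1, fun k hk => ?_⟩
    obtain ⟨k, rfl⟩ := Nat.exists_eq_add_of_le' ((Nat.le_add_left 1 n).trans hk)
    rw [hdneg, hφ, ← lt_inv_mul_iff₀' hφ1pos, mul_one]
    exact (pow_le_pow_of_le_one hc0.le hc1.le (by omega)).trans_lt hn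

end
end

section
/- Define Δ(θ,p) := 2pθ + (1-p)² M₂(θ/(1-p)) − M₂(θ) for θ > 0 and 0 ≤ p < 1, where M₂(θ) = θ + θ e^{-2θ}(I₀(2θ) + I₁(2θ)). Then for every θ > 0, the partial derivative of Δ with respect to θ evaluated at (θ,0) equals 0, and the partial derivative of Δ with respect to p evaluated at (θ,0) equals 2θ − M₂(θ) − θ² e^{-2θ} (I₀(2θ) − I₂(2θ)). -/
open MeasureTheory Filter Topology ProbabilityTheory

noncomputable section

/-- The entire function `Σ y^j / (j! (j+n)!)`, which satisfies
`I_n(x) = (x/2)^n F_n(x²/4)`. -/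
def besselSeries (n : ℕ) (y : ℝ) : ℝ :=
  ∑' j : ℕ, y ^ j / (j.factorial * (j + n).factorial)

theorem summable_besselSeries (n : ℕ) (y : ℝ) :
    Summable fun j : ℕ => y ^ j / ((j.factorial : ℝ) * (j + n).factorial) := by
  refine Summable.of_norm_bounded (Real.summable_pow_div_factorial |y|) fun j => ?_
  have h : (1 : ℝ) ≤ (j + n).factorial := by exact_mod_cast (j + n).factorial_pos
  have h' : (0 : ℝ) < j.factorial := by exact_mod_cast j.factorial_pos
  rw [Real.norm_eq_abs, abs_div, abs_pow, abs_of_pos (mul_pos h' (by linarith))]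
  gcongr
  nlinarith

theorem besselI_eq_mul_besselSeries (n : ℕ) (x : ℝ) :
    besselI n x = (x / 2) ^ n * besselSeries n ((x / 2) ^ 2) := by
  unfold besselI besselSeries
  rw [← tsum_mul_left]
  refine tsum_congr fun j => ?_
  rw [pow_add, pow_mul]
  ring

theorem hasDerivAt_besselSeries (n : ℕ) (y : ℝ) :
    HasDerivAt (besselSeries n) (besselSeries (n + 1) y) y := by
  have hsplit : besselSeries n = fun z => 1 / (n.factorial : ℝ) +
      ∑' j : ℕ, z ^ (j + 1) / (((j + 1).factorial : ℝ) * (j + 1 + n).factorial) := by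
    funext z
    rw [besselSeries, (summable_besselSeries n z).tsum_eq_zero_add]
    simp
  rw [hsplit]
  refine HasDerivAt.const_add _ ?_
  have hsum : Summable fun j : ℕ =>
      y ^ (j + 1) / (((j + 1).factorial : ℝ) * (j + 1 + n).factorial) :=
    (summable_nat_add_iff 1).2 (summable_besselSeries n y)
  have hy : y ∈ Metric.ball (0 : ℝ) (|y| + 1) := by simp
  have hderiv (j : ℕ) (z : ℝ) :
      HasDerivAt (fun z : ℝ => z ^ (j + 1) / (((j + 1).factorial : ℝ) * (j + 1 + n).factorial))
        (z ^ j / ((j.factorial : ℝ) * (j + (n + 1)).factorial)) z := by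
    refine ((hasDerivAt_pow (j + 1) z).div_const _).congr_deriv ?_
    rw [Nat.factorial_succ j, show j + 1 + n = j + (n + 1) by ring, Nat.add_sub_cancel]
    have h₁ : (j.factorial : ℝ) ≠ 0 := by positivity
    have h₂ : ((j + (n + 1)).factorial : ℝ) ≠ 0 := by positivity
    push_cast
    field_simp
  refine hasDerivAt_tsum_of_isPreconnected (summable_besselSeries (n + 1) (|y| + 1))
    Metric.isOpen_ball (convex_ball (0 : ℝ) _).isPreconnected (fun j z _ => hderiv j z)
    (fun j z hz => ?_) hy hsum hy
  rw [mem_ball_zero_iff, Real.norm_eq_abs] at hz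
  have hpos : (0 : ℝ) < (j.factorial : ℝ) * (j + (n + 1)).factorial := by positivity
  rw [Real.norm_eq_abs, abs_div, abs_pow, abs_of_pos hpos]
  gcongr

theorem besselSeries_recurrence (n : ℕ) (y : ℝ) :
    besselSeries n y - y * besselSeries (n + 2) y = (n + 1) * besselSeries (n + 1) y := by
  unfold besselSeries
  rw [(summable_besselSeries n y).tsum_eq_zero_add,
    (summable_besselSeries (n + 1) y).tsum_eq_zero_add, add_sub_assoc, ← tsum_mul_left,
    ← ((summable_nat_add_iff 1).2 (summable_besselSeries n y)).tsum_sub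
      ((summable_besselSeries (n + 2) y).mul_left y), mul_add, ← tsum_mul_left]
  congr 1
  · have h : (n.factorial : ℝ) ≠ 0 := by positivity
    simp only [Nat.factorial_succ, zero_add, pow_zero, Nat.factorial_zero]
    push_cast
    field_simp
  · refine tsum_congr fun j => ?_
    rw [show j + 1 + n = j + n + 1 by ring, show j + (n + 2) = j + n + 1 + 1 by ring,
      show j + 1 + (n + 1) = j + n + 1 + 1 by ring, Nat.factorial_succ (j + n + 1),
      Nat.factorial_succ j]
    have h₁ : (j.factorial : ℝ) ≠ 0 := by positivity
    have h₂ : ((j + n + 1).factorial : ℝ) ≠ 0 := by positivity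
    push_cast
    field_simp
    ring

theorem hasDerivAt_besselSeries_sq_half (n : ℕ) (x : ℝ) :
    HasDerivAt (fun z => besselSeries n ((z / 2) ^ 2))
      (besselSeries (n + 1) ((x / 2) ^ 2) * (x / 2)) x := by
  refine ((hasDerivAt_besselSeries n ((x / 2) ^ 2)).comp x
    (((hasDerivAt_id x).div_const 2).pow 2)).congr_deriv ?_
  simp only [id]
  push_cast
  ring

theorem hasDerivAt_besselI_zero (x : ℝ) : HasDerivAt (besselI 0) (besselI 1 x) x := by
  rw [funext (besselI_eq_mul_besselSeries 0), besselI_eq_mul_besselSeries]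
  simp only [pow_zero, one_mul, pow_one]
  exact (hasDerivAt_besselSeries_sq_half 0 x).congr_deriv (mul_comm _ _)

theorem hasDerivAt_besselI_succ (n : ℕ) (x : ℝ) :
    HasDerivAt (besselI (n + 1)) ((besselI n x + besselI (n + 2) x) / 2) x := by
  rw [funext (besselI_eq_mul_besselSeries (n + 1)), besselI_eq_mul_besselSeries n,
    besselI_eq_mul_besselSeries (n + 2)]
  refine ((((hasDerivAt_id x).div_const 2).pow (n + 1)).mul
    (hasDerivAt_besselSeries_sq_half (n + 1) x)).congr_deriv ?_
  have h := besselSeries_recurrence n ((x / 2) ^ 2)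
  simp only [id, Pi.pow_apply, Nat.add_sub_cancel]
  push_cast
  linear_combination (-(x / 2) ^ n / 2) * h

theorem hasDerivAt_M₂ (x : ℝ) :
    HasDerivAt M₂ (1 + Real.exp (-2 * x) * (besselI 0 (2 * x) + besselI 1 (2 * x)) -
      x * Real.exp (-2 * x) * (besselI 0 (2 * x) - besselI 2 (2 * x))) x := by
  have hlin (c : ℝ) : HasDerivAt (fun z : ℝ => c * z) c x := by
    simpa using (hasDerivAt_id x).const_mul c
  have h₀ := (hasDerivAt_besselI_zero (2 * x)).comp x (hlin 2)
  have h₁ := (hasDerivAt_besselI_succ 0 (2 * x)).comp x (hlin 2)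
  refine ((hasDerivAt_id x).add
    (((hasDerivAt_id x).mul (hlin (-2)).exp).mul (h₀.add h₁))).congr_deriv ?_
  simp only [id, Pi.mul_apply, Pi.add_apply, Function.comp_apply, zero_add]
  ring

/-- With `Δ(θ,p) = 2pθ + (1-p)² M₂(θ/(1-p)) − M₂(θ)`, for every `θ > 0`
the partial derivative of `Δ` with respect to `θ` at `(θ,0)` is `0`, and the partial
derivative of `Δ` with respect to `p` at `(θ,0)` equals
`2θ − M₂(θ) − θ² e^{-2θ}(I₀(2θ) − I₂(2θ))`. -/
theorem deriv_Δdisc_at_p_zero (θ : ℝ) (hθ : 0 < θ) :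
    HasDerivAt (fun θ' => Δdisc θ' 0) 0 θ ∧
      HasDerivAt (fun p' => Δdisc θ p')
        (2 * θ - M₂ θ - θ ^ 2 * Real.exp (-2 * θ) * (besselI 0 (2 * θ) - besselI 2 (2 * θ)))
        0 := by
  constructor
  · have h : (fun θ' => Δdisc θ' 0) = fun _ => 0 := by
      funext θ'
      simp [Δdisc]
    rw [h]
    exact hasDerivAt_const θ 0
  · have hsub : HasDerivAt (fun p : ℝ => 1 - p) (-1) 0 := (hasDerivAt_id 0).const_sub 1
    have hdiv : HasDerivAt (fun p : ℝ => θ / (1 - p)) θ 0 := by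
      refine ((hasDerivAt_const (0 : ℝ) θ).div hsub (by norm_num)).congr_deriv ?_
      norm_num
    have hM : HasDerivAt M₂ _ (θ / (1 - 0)) := hasDerivAt_M₂ _
    refine (((((hasDerivAt_id (0 : ℝ)).const_mul 2).mul_const θ).add
      ((hsub.pow 2).mul (hM.comp 0 hdiv))).sub_const (M₂ θ)).congr_deriv ?_
    simp only [Pi.pow_apply, Function.comp_apply, sub_zero, div_one, M₂]
    norm_num
    ring

end
end
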